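/- Let G = (V,E) be a finite simple graph with maximum degree at most Δ (Δ ≥ 1), let i ∈ E, and let λ > 0. Then there exists a coupling π of the Gibbs distributions μ_{G,λ} and μ_{G−i,λ} (where G−i is G with edge i deleted) such that E_{(M,M') ∼ π}[|M △ M'|] ≤ 1 + 2λΔ. In particular, the Wasserstein distance with respect to the edge-Hamming metric between μ_{G,λ} and μ_{G−i,λ} is at most 1 + 2λΔ. -/

import Mathlib

open scoped Classical

namespace SensMatching

variable {V : Type*} [Fintype V] [DecidableEq V]

/-- `M` is a matching of `G`: a finset of edges of `G`, no two of which share an endpoint. -/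
def IsMatchingSet (G : SimpleGraph V) (M : Finset (Sym2 V)) : Prop :=
  (∀ e ∈ M, e ∈ G.edgeSet) ∧
    ∀ e ∈ M, ∀ f ∈ M, e ≠ f → ∀ v : V, v ∈ e → v ∉ f

/-- The finset of all matchings of `G`. -/
noncomputable def matchings (G : SimpleGraph V) : Finset (Finset (Sym2 V)) :=
  Finset.univ.filter fun M => IsMatchingSet G M

/-- `ν(G)`: the maximum size of a matching of `G`. -/
noncomputable def nu (G : SimpleGraph V) : ℕ :=
  (matchings G).sup Finset.card

/-- `m_k(G)`: the number of matchings of size `k` in `G`. -/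
noncomputable def numMatchings (G : SimpleGraph V) (k : ℕ) : ℕ :=
  ((matchings G).filter fun M => M.card = k).card

/-- The degree of a vertex `v` in `G`. -/
noncomputable def degr (G : SimpleGraph V) (v : V) : ℕ :=
  (Finset.univ.filter fun w => G.Adj v w).card

/-- The finset of edges of `G`. -/
noncomputable def edges (G : SimpleGraph V) : Finset (Sym2 V) :=
  Finset.univ.filter fun e => e ∈ G.edgeSet

/-- The partition function `Z_G(λ) = Σ_{M matching} λ^{|M|}`. -/
noncomputable def partitionFn (G : SimpleGraph V) (lam : ℝ) : ℝ :=
  ∑ M ∈ matchings G, lam ^ M.card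

/-- The probability, under the Gibbs distribution `μ_{G,λ}`, of the event `p`. -/
noncomputable def gibbsProb (G : SimpleGraph V) (lam : ℝ) (p : Finset (Sym2 V) → Prop) : ℝ :=
  (∑ M ∈ (matchings G).filter p, lam ^ M.card) / partitionFn G lam

/-- The law of `f M`, where `M` follows the Gibbs distribution `μ_{G,λ}` conditioned
on the event `p`. -/
noncomputable def condDistMap (G : SimpleGraph V) (lam : ℝ) (p : Finset (Sym2 V) → Prop)
    (f : Finset (Sym2 V) → Finset (Sym2 V)) (N : Finset (Sym2 V)) : ℝ :=
  (∑ M ∈ ((matchings G).filter p).filter fun M => f M = N, lam ^ M.card) /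
    ∑ M ∈ (matchings G).filter p, lam ^ M.card

/-- The Gibbs distribution `μ_{G,λ}` conditioned on the event `p`. -/
noncomputable def condDist (G : SimpleGraph V) (lam : ℝ) (p : Finset (Sym2 V) → Prop) :
    Finset (Sym2 V) → ℝ :=
  condDistMap G lam p id

/-- The Gibbs distribution `μ_{G,λ}` over matchings of `G`. -/
noncomputable def gibbsDist (G : SimpleGraph V) (lam : ℝ) : Finset (Sym2 V) → ℝ :=
  condDist G lam fun _ => True

/-- `V(M)`: the set of vertices covered by the edge set `M`. -/
noncomputable def coveredVerts (M : Finset (Sym2 V)) : Finset V :=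
  Finset.univ.filter fun v => ∃ e ∈ M, v ∈ e

/-- `N(i)`: the set of edges of `G` sharing an endpoint with `i`, excluding `i` itself. -/
def edgeNbhd (G : SimpleGraph V) (i : Sym2 V) : Set (Sym2 V) :=
  {e | e ∈ G.edgeSet ∧ e ≠ i ∧ ∃ v : V, v ∈ e ∧ v ∈ i}

/-- `π` is a coupling of the distributions `μ` and `μ'`. -/
def IsCoupling {α : Type*} [Fintype α] (π : α × α → ℝ) (μ μ' : α → ℝ) : Prop :=
  (∀ q, 0 ≤ π q) ∧ (∀ a, ∑ b, π (a, b) = μ a) ∧ ∀ b, ∑ a, π (a, b) = μ' b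

/-- The edge-Hamming distance `|M △ M'|`. -/
noncomputable def edist (M M' : Finset (Sym2 V)) : ℕ :=
  ((M \ M') ∪ (M' \ M)).card

/-- The vertex-Hamming distance `|V(M) △ V(M')|`. -/
noncomputable def vdist (M M' : Finset (Sym2 V)) : ℕ :=
  ((coveredVerts M \ coveredVerts M') ∪ (coveredVerts M' \ coveredVerts M)).card

/-- The vertex-Hamming distance ignoring the vertex `u`: `|(V(M) △ V(M')) \ {u}|`. -/
noncomputable def vdistErase (u : V) (M M' : Finset (Sym2 V)) : ℕ :=
  (((coveredVerts M \ coveredVerts M') ∪ (coveredVerts M' \ coveredVerts M)).erase u).card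

/-- `M` satisfies the vertex pinning `(Bp, Bm)`: every vertex of `Bp` is covered by `M`
and no vertex of `Bm` is covered by `M`. -/
def satisfiesPinning (M : Finset (Sym2 V)) (Bp Bm : Finset V) : Prop :=
  (∀ w ∈ Bp, w ∈ coveredVerts M) ∧ ∀ w ∈ Bm, w ∉ coveredVerts M

/-- The Wasserstein distance between `μ` and `μ'` with respect to the metric `d`:
the infimum over couplings of the expected distance. -/
noncomputable def wass {α : Type*} [Fintype α] (d : α → α → ℝ) (μ μ' : α → ℝ) : ℝ :=
  sInf {c : ℝ | ∃ π : α × α → ℝ, IsCoupling π μ μ' ∧ c = ∑ q : α × α, π q * d q.1 q.2}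

section Coupling

variable {α ι : Type*} [Fintype α] {d : α → α → ℝ} {μ ν κ : α → ℝ} {b c : ℝ}

/-- The distributions `μ` and `ν` have a coupling of expected `d`-distance at most `c`. -/
def HasCoupling (d : α → α → ℝ) (μ ν : α → ℝ) (c : ℝ) : Prop :=
  ∃ π : α × α → ℝ, IsCoupling π μ ν ∧ ∑ q : α × α, π q * d q.1 q.2 ≤ c

/-- The pushforward of the distribution `μ` under `f`. -/
noncomputable def pushforward (f : α → α) (μ : α → ℝ) (a : α) : ℝ :=
  ∑ x, if f x = a then μ x else 0

theorem HasCoupling.mono (h : HasCoupling d μ ν b) (hbc : b ≤ c) : HasCoupling d μ ν c := by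
  obtain ⟨π, hπ, hc⟩ := h
  exact ⟨π, hπ, hc.trans hbc⟩

theorem HasCoupling.refl (hd : ∀ a, d a a = 0) (hμ : ∀ a, 0 ≤ μ a) : HasCoupling d μ μ 0 := by
  refine ⟨fun q => if q.1 = q.2 then μ q.1 else 0, ⟨fun q => ?_, fun a => ?_, fun b => ?_⟩, ?_⟩
  · dsimp only
    split_ifs
    exacts [hμ _, le_rfl]
  · simp
  · simp
  · refine (Finset.sum_eq_zero fun q _ => ?_).le
    by_cases h : q.1 = q.2
    · simp [h, hd]
    · simp [h]

theorem HasCoupling.symm (hd : ∀ a b, d a b = d b a) (h : HasCoupling d μ ν c) :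
    HasCoupling d ν μ c := by
  obtain ⟨π, ⟨h0, h1, h2⟩, hc⟩ := h
  refine ⟨fun q => π q.swap, ⟨fun q => h0 _, h2, h1⟩, le_of_eq_of_le ?_ hc⟩
  exact Fintype.sum_equiv (Equiv.prodComm α α) _ _ fun q => by
    simp [hd q.1 q.2]

theorem HasCoupling.const_mul {t : ℝ} (ht : 0 ≤ t) (h : HasCoupling d μ ν c) :
    HasCoupling d (fun a => t * μ a) (fun a => t * ν a) (t * c) := by
  obtain ⟨π, ⟨h0, h1, h2⟩, hc⟩ := h
  refine ⟨fun q => t * π q, ⟨fun q => mul_nonneg ht (h0 q), fun a => ?_, fun a => ?_⟩, ?_⟩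
  · rw [← Finset.mul_sum, h1]
  · rw [← Finset.mul_sum, h2]
  · simp_rw [mul_assoc, ← Finset.mul_sum]
    exact mul_le_mul_of_nonneg_left hc ht

theorem HasCoupling.add {μ' ν' : α → ℝ} (h : HasCoupling d μ ν b) (h' : HasCoupling d μ' ν' c) :
    HasCoupling d (fun a => μ a + μ' a) (fun a => ν a + ν' a) (b + c) := by
  obtain ⟨π, ⟨h0, h1, h2⟩, hc⟩ := h
  obtain ⟨π', ⟨h0', h1', h2'⟩, hc'⟩ := h'
  refine ⟨fun q => π q + π' q, ⟨fun q => add_nonneg (h0 q) (h0' q), fun a => ?_, fun a => ?_⟩, ?_⟩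
  · rw [Finset.sum_add_distrib, h1, h1']
  · rw [Finset.sum_add_distrib, h2, h2']
  · simp_rw [add_mul, Finset.sum_add_distrib]
    exact add_le_add hc hc'

theorem HasCoupling.sum (T : Finset ι) {m n : ι → α → ℝ} {k : ι → ℝ}
    (h : ∀ j ∈ T, HasCoupling d (m j) (n j) (k j)) :
    HasCoupling d (fun a => ∑ j ∈ T, m j a) (fun a => ∑ j ∈ T, n j a) (∑ j ∈ T, k j) := by
  induction T using Finset.induction_on with
  | empty => exact ⟨fun _ => 0, ⟨by simp, by simp, by simp⟩, by simp⟩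
  | insert j T hj ih =>
    simp_rw [Finset.sum_insert hj]
    exact (h j (Finset.mem_insert_self j T)).add
      (ih fun l hl => h l (Finset.mem_insert_of_mem hl))

theorem HasCoupling.trans (hd : ∀ x y z, d x z ≤ d x y + d y z)
    (h : HasCoupling d μ ν b) (h' : HasCoupling d ν κ c) : HasCoupling d μ κ (b + c) := by
  obtain ⟨π, ⟨h0, h1, h2⟩, hc⟩ := h
  obtain ⟨π', ⟨h0', h1', h2'⟩, hc'⟩ := h'
  have hz : ∀ x y, ν y = 0 → π (x, y) = 0 := fun x y hy =>
    (Finset.sum_eq_zero_iff_of_nonneg fun x _ => h0 (x, y)).1 ((h2 y).trans hy) x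
      (Finset.mem_univ x)
  have hz' : ∀ y z, ν y = 0 → π' (y, z) = 0 := fun y z hy =>
    (Finset.sum_eq_zero_iff_of_nonneg fun z _ => h0' (y, z)).1 ((h1' y).trans hy) z
      (Finset.mem_univ z)
  have hν : ∀ y, 0 ≤ ν y := fun y => h2 y ▸ Finset.sum_nonneg fun x _ => h0 (x, y)
  set ρ : α → α → α → ℝ := fun x y z => π (x, y) * π' (y, z) / ν y with hρ
  have hρ0 : ∀ x y z, 0 ≤ ρ x y z := fun x y z =>
    div_nonneg (mul_nonneg (h0 _) (h0' _)) (hν y)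
  have hρ1 : ∀ x y, ∑ z, ρ x y z = π (x, y) := fun x y => by
    simp only [hρ]
    rw [← Finset.sum_div, ← Finset.mul_sum, h1']
    by_cases hy : ν y = 0
    · simp [hy, hz x y hy]
    · exact mul_div_cancel_right₀ _ hy
  have hρ2 : ∀ y z, ∑ x, ρ x y z = π' (y, z) := fun y z => by
    simp only [hρ]
    rw [← Finset.sum_div, ← Finset.sum_mul, h2]
    by_cases hy : ν y = 0
    · simp [hy, hz' y z hy]
    · exact mul_div_cancel_left₀ _ hy
  refine ⟨fun q => ∑ y, ρ q.1 y q.2,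
    ⟨fun q => Finset.sum_nonneg fun y _ => hρ0 _ _ _, fun x => ?_, fun z => ?_⟩, ?_⟩
  · rw [Finset.sum_comm, ← h1 x]
    exact Finset.sum_congr rfl fun y _ => hρ1 x y
  · rw [Finset.sum_comm, ← h2' z]
    exact Finset.sum_congr rfl fun y _ => hρ2 y z
  · rw [Fintype.sum_prod_type] at hc hc' ⊢
    dsimp only at hc hc' ⊢
    calc ∑ x, ∑ z, (∑ y, ρ x y z) * d x z
        ≤ ∑ x, ∑ z, ∑ y, (ρ x y z * d x y + ρ x y z * d y z) := by
          refine Finset.sum_le_sum fun x _ => Finset.sum_le_sum fun z _ => ?_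
          rw [Finset.sum_mul]
          refine Finset.sum_le_sum fun y _ => ?_
          rw [← mul_add]
          exact mul_le_mul_of_nonneg_left (hd x y z) (hρ0 x y z)
      _ = ∑ x, ∑ y, π (x, y) * d x y + ∑ y, ∑ z, π' (y, z) * d y z := by
          simp_rw [Finset.sum_add_distrib]
          congr 1
          · refine Finset.sum_congr rfl fun x _ => ?_
            rw [Finset.sum_comm]
            refine Finset.sum_congr rfl fun y _ => ?_
            rw [← Finset.sum_mul, hρ1]
          · rw [Finset.sum_comm, Finset.sum_comm (f := fun y z => π' (y, z) * d y z)]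
            refine Finset.sum_congr rfl fun z _ => ?_
            rw [Finset.sum_comm]
            refine Finset.sum_congr rfl fun y _ => ?_
            rw [← Finset.sum_mul, hρ2]
      _ ≤ b + c := add_le_add hc hc'

theorem sum_pushforward (f : α → α) (μ : α → ℝ) : ∑ a, pushforward f μ a = ∑ a, μ a := by
  unfold pushforward
  rw [Finset.sum_comm]
  simp

theorem pushforward_const_mul (f : α → α) (t : ℝ) (μ : α → ℝ) (a : α) :
    pushforward f (fun x => t * μ x) a = t * pushforward f μ a := by
  unfold pushforward
  rw [Finset.mul_sum]
  exact Finset.sum_congr rfl fun x _ => by split_ifs <;> simp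

/-- Pushing forward along a map moving points by at most `1` costs at most the total mass. -/
theorem HasCoupling.pushforward_left (hd : ∀ x y z, d x z ≤ d x y + d y z)
    {f : α → α} (hf : ∀ a, d (f a) a ≤ 1) (hμ1 : ∑ a, μ a = 1) (h : HasCoupling d μ ν c) :
    HasCoupling d (pushforward f μ) ν (1 + c) := by
  have hμ : ∀ a, 0 ≤ μ a := by
    obtain ⟨π, ⟨h0, h1, -⟩, -⟩ := h
    exact fun a => h1 a ▸ Finset.sum_nonneg fun b _ => h0 (a, b)
  refine HasCoupling.trans hd ?_ h
  refine ⟨fun q => if f q.2 = q.1 then μ q.2 else 0, ⟨fun q => ?_, fun a => rfl, ?_⟩, ?_⟩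
  · dsimp only
    split_ifs
    exacts [hμ _, le_rfl]
  · simp
  · rw [Fintype.sum_prod_type, Finset.sum_comm, ← hμ1]
    refine Finset.sum_le_sum fun y _ => ?_
    simp only [ite_mul, zero_mul, Finset.sum_ite_eq, Finset.mem_univ, if_true]
    exact mul_le_of_le_one_right (hμ y) (hf y)

/-- A mixture of `ν` and of pushforwards of distributions close to `ν` is close to `ν`. -/
theorem HasCoupling.of_mixture (hd : ∀ x y z, d x z ≤ d x y + d y z) (hd0 : ∀ a, d a a = 0)
    (hν : ∀ a, 0 ≤ ν a) (T : Finset ι) {f : ι → α → α} {m : ι → α → ℝ} {t₀ : ℝ} {t : ι → ℝ}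
    (ht₀ : 0 ≤ t₀) (ht : ∀ j ∈ T, 0 ≤ t j) (ht1 : t₀ + ∑ j ∈ T, t j = 1)
    (hf : ∀ j ∈ T, ∀ a, d (f j a) a ≤ 1) (hm1 : ∀ j ∈ T, ∑ a, m j a = 1)
    (hm : ∀ j ∈ T, HasCoupling d (m j) ν c)
    (hμ : ∀ a, μ a = t₀ * ν a + ∑ j ∈ T, t j * pushforward (f j) (m j) a) :
    HasCoupling d μ ν ((∑ j ∈ T, t j) * (1 + c)) := by
  have h := ((HasCoupling.refl hd0 hν).const_mul ht₀).add
    (HasCoupling.sum T fun j hj =>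
      ((hm j hj).pushforward_left hd (hf j hj) (hm1 j hj)).const_mul (ht j hj))
  simp_rw [← Finset.sum_mul, ← add_mul, ht1, one_mul, mul_zero, zero_add] at h
  rwa [← funext hμ] at h

end Coupling

section EdgeDistance

theorem edist_self (M : Finset (Sym2 V)) : edist M M = 0 := by
  simp [edist]

omit [Fintype V] in
theorem edist_comm (M N : Finset (Sym2 V)) : edist M N = edist N M := by
  rw [edist, edist, Finset.union_comm]

omit [Fintype V] in
theorem edist_triangle (L M N : Finset (Sym2 V)) : edist L N ≤ edist L M + edist M N := by
  unfold edist
  refine (Finset.card_le_card fun x hx => ?_).trans (Finset.card_union_le _ _)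
  simp only [Finset.mem_union, Finset.mem_sdiff] at hx ⊢
  tauto

omit [Fintype V] in
theorem edist_insert_self_le (e : Sym2 V) (M : Finset (Sym2 V)) : edist (insert e M) M ≤ 1 := by
  refine (Finset.card_le_card (t := {e}) fun x hx => ?_).trans (Finset.card_singleton e).le
  simp only [Finset.mem_union, Finset.mem_sdiff, Finset.mem_insert, Finset.mem_singleton] at hx ⊢
  tauto

end EdgeDistance

section AvoidingMatchings

variable {G : SimpleGraph V} {lam : ℝ} {S : Finset V} {N : Finset (Sym2 V)} {u w : V}

/-- `N` is a matching of `G` covering no vertex of `S`. -/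
def IsMatchingAvoiding (G : SimpleGraph V) (S : Finset V) (N : Finset (Sym2 V)) : Prop :=
  IsMatchingSet G N ∧ ∀ e ∈ N, ∀ v ∈ e, v ∉ S

/-- The unnormalized Gibbs weight on the matchings of `G` covering no vertex of `S`. -/
noncomputable def avoidWeight (G : SimpleGraph V) (lam : ℝ) (S : Finset V)
    (N : Finset (Sym2 V)) : ℝ :=
  if IsMatchingAvoiding G S N then lam ^ N.card else 0

/-- The partition function of the matchings of `G` covering no vertex of `S`. -/
noncomputable def avoidPartitionFn (G : SimpleGraph V) (lam : ℝ) (S : Finset V) : ℝ :=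
  ∑ N, avoidWeight G lam S N

/-- The Gibbs distribution on the matchings of `G` covering no vertex of `S`. -/
noncomputable def avoidDist (G : SimpleGraph V) (lam : ℝ) (S : Finset V)
    (N : Finset (Sym2 V)) : ℝ :=
  (avoidPartitionFn G lam S)⁻¹ * avoidWeight G lam S N

omit [Fintype V] [DecidableEq V] in
theorem avoidWeight_nonneg (hlam : 0 < lam) : 0 ≤ avoidWeight G lam S N := by
  unfold avoidWeight
  split_ifs <;> positivity

omit [DecidableEq V] in
theorem avoidPartitionFn_pos (hlam : 0 < lam) : 0 < avoidPartitionFn G lam S := by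
  refine Finset.sum_pos' (fun N _ => avoidWeight_nonneg hlam) ⟨∅, Finset.mem_univ _, ?_⟩
  simp [avoidWeight, IsMatchingAvoiding, IsMatchingSet]

omit [DecidableEq V] in
theorem avoidDist_nonneg (hlam : 0 < lam) : 0 ≤ avoidDist G lam S N :=
  mul_nonneg (inv_nonneg.2 (avoidPartitionFn_pos hlam).le) (avoidWeight_nonneg hlam)

omit [DecidableEq V] in
theorem sum_avoidDist (hlam : 0 < lam) : ∑ N, avoidDist G lam S N = 1 := by
  unfold avoidDist
  rw [← Finset.mul_sum]
  exact inv_mul_cancel₀ (avoidPartitionFn_pos hlam).ne'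

omit [DecidableEq V] in
theorem avoidPartitionFn_anti (hlam : 0 < lam) {S T : Finset V} (h : S ⊆ T) :
    avoidPartitionFn G lam T ≤ avoidPartitionFn G lam S := by
  refine Finset.sum_le_sum fun N _ => ?_
  by_cases hT : IsMatchingAvoiding G T N
  · have hS : IsMatchingAvoiding G S N := ⟨hT.1, fun e he v hv hvS => hT.2 e he v hv (h hvS)⟩
    simp [avoidWeight, hT, hS]
  · simpa [avoidWeight, hT] using avoidWeight_nonneg (G := G) (S := S) (N := N) hlam

theorem gibbsDist_eq_avoidDist (G : SimpleGraph V) (lam : ℝ) :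
    gibbsDist G lam = avoidDist G lam ∅ := by
  funext N
  have hw : ∀ M, avoidWeight G lam ∅ M = if IsMatchingSet G M then lam ^ M.card else 0 := by
    simp [avoidWeight, IsMatchingAvoiding]
  have hZ : avoidPartitionFn G lam ∅ = ∑ M ∈ matchings G, lam ^ M.card := by
    simp only [avoidPartitionFn, hw, matchings, Finset.sum_filter]
  have hN : ∑ M ∈ (matchings G).filter (fun M => M = N), lam ^ M.card =
      avoidWeight G lam ∅ N := by
    rw [hw, Finset.sum_filter, Finset.sum_ite_eq']
    simp [matchings]
  simp only [gibbsDist, condDist, condDistMap, Finset.filter_true, id, avoidDist]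
  rw [hZ, hN, div_eq_inv_mul]

omit [Fintype V] in
theorem isMatchingAvoiding_erase_iff (huw : G.Adj u w) (hu : u ∉ S) (hw : w ∉ S)
    (he : s(u, w) ∈ N) :
    IsMatchingAvoiding G (insert u (insert w S)) (N.erase s(u, w)) ↔
      IsMatchingAvoiding G S N := by
  constructor
  · rintro ⟨⟨h1, h2⟩, h3⟩
    have key : ∀ f ∈ N, f ≠ s(u, w) → ∀ v ∈ f, v ≠ u ∧ v ≠ w ∧ v ∉ S := fun f hf hfe v hv => by
      simpa using h3 f (Finset.mem_erase.2 ⟨hfe, hf⟩) v hv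
    refine ⟨⟨fun f hf => ?_, fun f hf g hg hfg v hvf hvg => ?_⟩, fun f hf v hv => ?_⟩
    · by_cases hfe : f = s(u, w)
      · simpa [hfe] using huw
      · exact h1 f (Finset.mem_erase.2 ⟨hfe, hf⟩)
    · by_cases hfe : f = s(u, w)
      · subst hfe
        have := key g hg hfg.symm v hvg
        rw [Sym2.mem_iff] at hvf
        tauto
      · by_cases hge : g = s(u, w)
        · subst hge
          have := key f hf hfg v hvf
          rw [Sym2.mem_iff] at hvg
          tauto
        · exact h2 f (Finset.mem_erase.2 ⟨hfe, hf⟩) g (Finset.mem_erase.2 ⟨hge, hg⟩) hfg v hvf hvg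
    · by_cases hfe : f = s(u, w)
      · subst hfe
        rw [Sym2.mem_iff] at hv
        rcases hv with rfl | rfl <;> assumption
      · exact (key f hf hfe v hv).2.2
  · rintro ⟨⟨h1, h2⟩, h3⟩
    refine ⟨⟨fun f hf => h1 f (Finset.mem_of_mem_erase hf), fun f hf g hg =>
      h2 f (Finset.mem_of_mem_erase hf) g (Finset.mem_of_mem_erase hg)⟩, fun f hf v hv => ?_⟩
    have hN := Finset.mem_of_mem_erase hf
    have hne := Finset.ne_of_mem_erase hf
    simp only [Finset.mem_insert, not_or]
    refine ⟨?_, ?_, h3 f hN v hv⟩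
    · rintro rfl
      exact h2 f hN _ he hne v hv (Sym2.mem_mk_left _ _)
    · rintro rfl
      exact h2 f hN _ he hne v hv (Sym2.mem_mk_right _ _)

theorem mul_pushforward_avoidWeight (huw : G.Adj u w) (hu : u ∉ S) (hw : w ∉ S) :
    lam * pushforward (insert s(u, w)) (avoidWeight G lam (insert u (insert w S))) N =
      if s(u, w) ∈ N then avoidWeight G lam S N else 0 := by
  have hvanish : ∀ M : Finset (Sym2 V), s(u, w) ∈ M →
      avoidWeight G lam (insert u (insert w S)) M = 0 := fun M hM =>
    if_neg fun h => h.2 _ hM u (Sym2.mem_mk_left _ _) (Finset.mem_insert_self _ _)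
  unfold pushforward
  split_ifs with he
  · rw [Finset.sum_eq_single (N.erase s(u, w)), if_pos (Finset.insert_erase he)]
    · unfold avoidWeight
      rw [if_congr (isMatchingAvoiding_erase_iff huw hu hw he) rfl rfl, mul_ite, mul_zero,
        ← pow_succ', Finset.card_erase_add_one he]
    · intro M _ hM
      split_ifs with h
      · refine hvanish M (by_contra fun hn => hM ?_)
        rw [← h, Finset.erase_insert hn]
      · rfl
    · simp
  · rw [Finset.sum_eq_zero, mul_zero]
    intro M _
    rw [if_neg]
    rintro rfl
    exact he (Finset.mem_insert_self _ _)

/-- Splitting the matchings according to the edge, if any, covering the vertex `u`. -/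
theorem avoidWeight_eq_add_sum (hu : u ∉ S) :
    avoidWeight G lam S N = avoidWeight G lam (insert u S) N +
      ∑ w ∈ Finset.univ.filter (fun w => G.Adj u w ∧ w ∉ S),
        lam * pushforward (insert s(u, w)) (avoidWeight G lam (insert u (insert w S))) N := by
  rw [Finset.sum_congr rfl fun w hw => mul_pushforward_avoidWeight
    (Finset.mem_filter.1 hw).2.1 hu (Finset.mem_filter.1 hw).2.2]
  by_cases hN : IsMatchingAvoiding G S N
  · by_cases hc : ∃ e ∈ N, u ∈ e
    · obtain ⟨e, he, hue⟩ := hc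
      obtain ⟨w, rfl⟩ := Sym2.mem_iff_exists.1 hue
      have h0 : avoidWeight G lam (insert u S) N = 0 :=
        if_neg fun h => h.2 _ he u hue (Finset.mem_insert_self _ _)
      rw [h0, zero_add, Finset.sum_eq_single w, if_pos he]
      · intro w' _ hne
        refine if_neg fun he' => ?_
        refine hN.1.2 _ he _ he' (fun h => hne ?_) u hue (Sym2.mem_mk_left _ _)
        exact (Sym2.congr_right.1 h).symm
      · intro h
        refine absurd (Finset.mem_filter.2 ⟨Finset.mem_univ _, ?_, ?_⟩) h
        · simpa using hN.1.1 _ he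
        · exact hN.2 _ he w (Sym2.mem_mk_right _ _)
    · have hN' : IsMatchingAvoiding G (insert u S) N := by
        refine ⟨hN.1, fun e he v hv hvS => ?_⟩
        rcases Finset.mem_insert.1 hvS with rfl | h
        · exact hc ⟨e, he, hv⟩
        · exact hN.2 e he v hv h
      rw [Finset.sum_eq_zero, add_zero, avoidWeight, avoidWeight, if_pos hN, if_pos hN']
      intro w _
      exact if_neg fun he => hc ⟨_, he, Sym2.mem_mk_left _ _⟩
  · have hN' : ¬ IsMatchingAvoiding G (insert u S) N := fun h =>
      hN ⟨h.1, fun e he v hv hvS => h.2 e he v hv (Finset.mem_insert_of_mem hvS)⟩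
    simp [avoidWeight, hN, hN']

omit [Fintype V] [DecidableEq V] in
theorem isMatchingSet_deleteEdges_iff {i : Sym2 V} :
    IsMatchingSet (G.deleteEdges {i}) N ↔ IsMatchingSet G N ∧ i ∉ N := by
  simp only [IsMatchingSet, SimpleGraph.edgeSet_deleteEdges, Set.mem_sdiff, Set.mem_singleton_iff]
  constructor
  · rintro ⟨h1, h2⟩
    exact ⟨⟨fun e he => (h1 e he).1, h2⟩, fun hi => (h1 i hi).2 rfl⟩
  · rintro ⟨⟨h1, h2⟩, h3⟩
    exact ⟨fun e he => ⟨h1 e he, fun h => h3 (h ▸ he)⟩, h2⟩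

omit [Fintype V] [DecidableEq V] in
theorem avoidWeight_deleteEdges_of_mem (hu : u ∈ S) :
    avoidWeight (G.deleteEdges {s(u, w)}) lam S = avoidWeight G lam S := by
  funext N
  refine if_congr ?_ rfl rfl
  rw [IsMatchingAvoiding, IsMatchingAvoiding, isMatchingSet_deleteEdges_iff]
  exact ⟨fun h => ⟨h.1.1, h.2⟩,
    fun h => ⟨⟨h.1, fun he => h.2 _ he u (Sym2.mem_mk_left _ _) hu⟩, h.2⟩⟩

/-- Splitting the matchings according to whether they contain the edge `s(u, w)`. -/
theorem avoidWeight_eq_deleteEdges_add (huw : G.Adj u w) :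
    avoidWeight G lam ∅ N = avoidWeight (G.deleteEdges {s(u, w)}) lam ∅ N +
      lam * pushforward (insert s(u, w))
        (avoidWeight (G.deleteEdges {s(u, w)}) lam {u, w}) N := by
  rw [avoidWeight_deleteEdges_of_mem (S := {u, w}) (by simp)]
  have h := mul_pushforward_avoidWeight (lam := lam) (N := N) huw
    (Finset.notMem_empty u) (Finset.notMem_empty w)
  rw [show insert u (insert w (∅ : Finset V)) = {u, w} by simp] at h
  rw [h]
  by_cases he : s(u, w) ∈ N <;>
    simp [avoidWeight, IsMatchingAvoiding, isMatchingSet_deleteEdges_iff, he]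

/-- A decomposition of Gibbs weights yields a coupling of the Gibbs distributions. -/
theorem hasCoupling_avoidDist_of_weight {ι : Type*} {G H : SimpleGraph V} {S S₀ : Finset V}
    (hlam : 0 < lam) (T : Finset ι) {e : ι → Sym2 V} {R : ι → Finset V} {c : ℝ}
    (hw : ∀ N, avoidWeight G lam S N = avoidWeight H lam S₀ N +
      ∑ j ∈ T, lam * pushforward (insert (e j)) (avoidWeight H lam (R j)) N)
    (hc : ∀ j ∈ T, HasCoupling (fun M N => (edist M N : ℝ)) (avoidDist H lam (R j))
      (avoidDist H lam S₀) c) :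
    avoidPartitionFn G lam S =
        avoidPartitionFn H lam S₀ + ∑ j ∈ T, lam * avoidPartitionFn H lam (R j) ∧
      HasCoupling (fun M N => (edist M N : ℝ)) (avoidDist G lam S) (avoidDist H lam S₀)
        ((∑ j ∈ T, lam * avoidPartitionFn H lam (R j)) / avoidPartitionFn G lam S * (1 + c)) := by
  have hZ : avoidPartitionFn G lam S =
      avoidPartitionFn H lam S₀ + ∑ j ∈ T, lam * avoidPartitionFn H lam (R j) := by
    simp_rw [avoidPartitionFn, hw, Finset.sum_add_distrib]
    rw [Finset.sum_comm]
    simp_rw [← Finset.mul_sum, sum_pushforward]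
  refine ⟨hZ, ?_⟩
  have hpos := avoidPartitionFn_pos (G := G) (S := S) hlam
  have hpos' : ∀ R, 0 < avoidPartitionFn H lam R := fun R => avoidPartitionFn_pos hlam
  rw [Finset.sum_div]
  refine HasCoupling.of_mixture (t₀ := avoidPartitionFn H lam S₀ / avoidPartitionFn G lam S)
    (f := fun j => insert (e j)) (m := fun j => avoidDist H lam (R j)) ?_ ?_ ?_ T ?_ ?_ ?_ ?_ ?_
    hc ?_
  · intro L M N
    exact_mod_cast edist_triangle L M N
  · simp [edist_self]
  · exact fun N => avoidDist_nonneg hlam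
  · exact (div_pos (hpos' _) hpos).le
  · exact fun j _ => (div_pos (mul_pos hlam (hpos' _)) hpos).le
  · rw [← Finset.sum_div, ← add_div, ← hZ, div_self hpos.ne']
  · intro j _ M
    exact_mod_cast edist_insert_self_le (e j) M
  · exact fun j _ => sum_avoidDist hlam
  · intro N
    have h0 := (hpos' S₀).ne'
    unfold avoidDist
    simp_rw [pushforward_const_mul, hw N, mul_add, Finset.mul_sum]
    congr 1
    · field_simp
    · refine Finset.sum_congr rfl fun j _ => ?_
      have hj := (hpos' (R j)).ne'
      field_simp

/-- Forbidding one more vertex moves the Gibbs distribution by at most `λΔ`. -/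
theorem hasCoupling_avoidDist_insert {Δ : ℕ} (hdeg : ∀ v, degr G v ≤ Δ) (hlam : 0 < lam)
    (S : Finset V) (u : V) :
    HasCoupling (fun M N => (edist M N : ℝ)) (avoidDist G lam S) (avoidDist G lam (insert u S))
      (lam * Δ) := by
  induction hn : Sᶜ.card using Nat.strong_induction_on generalizing S u with
  | _ n ih =>
    by_cases hu : u ∈ S
    · rw [Finset.insert_eq_of_mem hu]
      exact (HasCoupling.refl (by simp [edist_self]) fun N => avoidDist_nonneg hlam).mono
        (by positivity)
    have hlt : (insert u S)ᶜ.card < n := by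
      rw [← hn]
      exact Finset.card_lt_card
        (Finset.compl_ssubset_compl.2 (Finset.ssubset_insert hu))
    obtain ⟨hZ, hC⟩ := hasCoupling_avoidDist_of_weight (G := G) (H := G) (S := S)
      (S₀ := insert u S) (c := lam * Δ) hlam
      (Finset.univ.filter fun w => G.Adj u w ∧ w ∉ S) (e := fun w => s(u, w))
      (R := fun w => insert u (insert w S)) (fun N => avoidWeight_eq_add_sum hu)
      (fun w _ => by
        rw [Finset.insert_comm]
        exact (ih _ hlt (insert u S) w rfl).symm fun M N => by rw [edist_comm])
    refine hC.mono ?_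
    set A := ∑ w ∈ Finset.univ.filter (fun w => G.Adj u w ∧ w ∉ S),
      lam * avoidPartitionFn G lam (insert u (insert w S)) with hA
    have hA_le : A ≤ lam * Δ * avoidPartitionFn G lam (insert u S) := by
      have hcard : (Finset.univ.filter fun w => G.Adj u w ∧ w ∉ S).card ≤ Δ :=
        (Finset.card_le_card
          (Finset.monotone_filter_right _ fun w _ hw => hw.1)).trans (hdeg u)
      have hpos := avoidPartitionFn_pos (G := G) (S := insert u S) hlam
      calc A ≤ ∑ w ∈ Finset.univ.filter (fun w => G.Adj u w ∧ w ∉ S),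
            lam * avoidPartitionFn G lam (insert u S) :=
            Finset.sum_le_sum fun w _ => mul_le_mul_of_nonneg_left
              (avoidPartitionFn_anti hlam
                (Finset.insert_subset_insert u (Finset.subset_insert w S))) hlam.le
        _ = ((Finset.univ.filter fun w => G.Adj u w ∧ w ∉ S).card : ℝ) *
            (lam * avoidPartitionFn G lam (insert u S)) := by
            rw [Finset.sum_const, nsmul_eq_mul]
        _ ≤ (Δ : ℝ) * (lam * avoidPartitionFn G lam (insert u S)) :=
            mul_le_mul_of_nonneg_right (by exact_mod_cast hcard) (by positivity)
        _ = lam * Δ * avoidPartitionFn G lam (insert u S) := by ring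
    rw [div_mul_eq_mul_div, div_le_iff₀ (avoidPartitionFn_pos hlam), hZ]
    linarith

end AvoidingMatchings

omit [DecidableEq V] in
theorem degr_mono {G H : SimpleGraph V} (h : G ≤ H) (v : V) : degr G v ≤ degr H v :=
  Finset.card_le_card (Finset.monotone_filter_right _ fun _ _ hw => h hw)

theorem wass_le_of_hasCoupling {α : Type*} [Fintype α] {d : α → α → ℝ} {μ ν : α → ℝ} {c : ℝ}
    (hd : ∀ a b, 0 ≤ d a b) (h : HasCoupling d μ ν c) : wass d μ ν ≤ c := by
  obtain ⟨π, hπ, hc⟩ := h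
  refine le_trans (csInf_le ?_ ⟨π, hπ, rfl⟩) hc
  refine ⟨0, ?_⟩
  rintro _ ⟨ρ, hρ, rfl⟩
  exact Finset.sum_nonneg fun q _ => mul_nonneg (hρ.1 q) (hd _ _)

/-- there is a coupling of `μ_{G,λ}` and `μ_{G−i,λ}` with expected
edge-Hamming distance at most `1 + 2λΔ`; in particular, the edge-Hamming Wasserstein
distance between `μ_{G,λ}` and `μ_{G−i,λ}` is at most `1 + 2λΔ`. -/
theorem stmt_10 {V : Type*} [Fintype V] [DecidableEq V]
    (G : SimpleGraph V) (Δ : ℕ) (hΔ : 1 ≤ Δ) (hdeg : ∀ v : V, degr G v ≤ Δ)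
    (i : Sym2 V) (hi : i ∈ G.edgeSet) (lam : ℝ) (hlam : 0 < lam) :
    (∃ π : Finset (Sym2 V) × Finset (Sym2 V) → ℝ,
      IsCoupling π (gibbsDist G lam) (gibbsDist (G.deleteEdges {i}) lam) ∧
      ∑ q : Finset (Sym2 V) × Finset (Sym2 V), π q * (edist q.1 q.2 : ℝ) ≤
        1 + 2 * lam * (Δ : ℝ)) ∧
    wass (fun M M' => (edist M M' : ℝ)) (gibbsDist G lam)
        (gibbsDist (G.deleteEdges {i}) lam) ≤ 1 + 2 * lam * (Δ : ℝ) := by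
  suffices h : HasCoupling (fun M M' => (edist M M' : ℝ)) (gibbsDist G lam)
      (gibbsDist (G.deleteEdges {i}) lam) (1 + 2 * lam * (Δ : ℝ)) by
    exact ⟨h, wass_le_of_hasCoupling (fun _ _ => Nat.cast_nonneg _) h⟩
  rw [gibbsDist_eq_avoidDist, gibbsDist_eq_avoidDist]
  induction i using Sym2.ind with
  | _ u w =>
    have huw : G.Adj u w := hi
    have hdeg' : ∀ v, degr (G.deleteEdges {s(u, w)}) v ≤ Δ := fun v =>
      (degr_mono (G.deleteEdges_le _) v).trans (hdeg v)
    have hpair : HasCoupling (fun M M' => (edist M M' : ℝ))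
        (avoidDist (G.deleteEdges {s(u, w)}) lam {u, w})
        (avoidDist (G.deleteEdges {s(u, w)}) lam ∅) (2 * lam * Δ) := by
      have h := (hasCoupling_avoidDist_insert hdeg' hlam ∅ w).trans
        (fun L M N => by exact_mod_cast edist_triangle L M N)
        (hasCoupling_avoidDist_insert hdeg' hlam (insert w ∅) u)
      refine (HasCoupling.symm (fun M N => by rw [edist_comm]) h).mono (by linarith)
    obtain ⟨hZ, hC⟩ := hasCoupling_avoidDist_of_weight (ι := Unit) (G := G) (S := ∅) hlam
      Finset.univ (e := fun _ => s(u, w)) (R := fun _ => {u, w})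
      (fun N => by simpa using avoidWeight_eq_deleteEdges_add huw) fun _ _ => hpair
    refine hC.mono (mul_le_of_le_one_left (by positivity) ?_)
    rw [div_le_one (avoidPartitionFn_pos hlam), hZ]
    exact le_add_of_nonneg_left (avoidPartitionFn_pos hlam).le

end SensMatching
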